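/- arXiv:0902.4741 — 2 statements merged into one kernel-verified Lean document; each statement's English description precedes it below -/
import Mathlib

section
/- Let a: [0,∞) → ℝ be locally integrable and y₀ ≥ 0. The function M defined by M(t) := sup{w(t) : w ∈ S(a, y₀)} for t ≥ 0 itself belongs to S(a, y₀); consequently y(t) := M(t)² is a nonnegative global solution of the Cauchy problem y' + 2a√y = 0, y(0) = y₀, and it is the maximal solution: y(t) ≥ z(t) for every t ≥ 0 and every nonnegative global solution z of the same Cauchy problem. -/
open MeasureTheory Set Filter

/-- `a` is locally integrable on `[0,∞)`. -/
def LocIntOn (a : ℝ → ℝ) : Prop :=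
  ∀ t : ℝ, 0 ≤ t → MeasureTheory.IntegrableOn a (Set.Icc 0 t) MeasureTheory.volume

/-- `y` is a nonnegative global solution of the Cauchy problem
`y' + 2 a √y = 0`, `y 0 = y₀`, in integral form. -/
def IsSol (a : ℝ → ℝ) (y₀ : ℝ) (y : ℝ → ℝ) : Prop :=
  ContinuousOn y (Set.Ici 0) ∧ (∀ t : ℝ, 0 ≤ t → 0 ≤ y t) ∧
    ∀ t : ℝ, 0 ≤ t → y t = y₀ - 2 * ∫ s in (0:ℝ)..t, a s * Real.sqrt (y s)

/-- Membership in the set `S(a, y₀)`. -/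
def MemS (a : ℝ → ℝ) (y₀ : ℝ) (w : ℝ → ℝ) : Prop :=
  (∀ t : ℝ, 0 ≤ t → 0 ≤ w t) ∧
    ∃ g : ℝ → ℝ,
      (∀ t : ℝ, 0 ≤ t → MeasureTheory.IntegrableOn g (Set.Icc 0 t) MeasureTheory.volume) ∧
      (∀ t : ℝ, 0 ≤ t → w t = Real.sqrt y₀ + ∫ s in (0:ℝ)..t, g s) ∧
      (∀ᵐ s ∂(MeasureTheory.volume : MeasureTheory.Measure ℝ), 0 ≤ s → 0 < w s → g s = -a s)

/-- `y` is the maximal nonnegative global solution. -/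
def IsMaxSol (a : ℝ → ℝ) (y₀ : ℝ) (y : ℝ → ℝ) : Prop :=
  IsSol a y₀ y ∧ ∀ z : ℝ → ℝ, IsSol a y₀ z → ∀ t : ℝ, 0 ≤ t → z t ≤ y t

open MeasureTheory Set Filter Topology

lemma ac_of_dom {f G : ℝ → ℝ} {p q C : ℝ} (hG : AbsolutelyContinuousOnInterval G p q)
    (h : ∀ u ∈ uIcc p q, ∀ v ∈ uIcc p q, |f u - f v| ≤ C * |G u - G v|) :
    AbsolutelyContinuousOnInterval f p q := by
  unfold AbsolutelyContinuousOnInterval at hG ⊢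
  have h2 := hG.const_mul C
  rw [mul_zero] at h2
  refine squeeze_zero' (Eventually.of_forall fun E => Finset.sum_nonneg fun _ _ => dist_nonneg) ?_ h2
  refine Filter.Eventually.filter_mono inf_le_right ?_
  rw [eventually_principal]
  intro E hE
  rw [Finset.mul_sum]
  refine Finset.sum_le_sum fun i hi => ?_
  have := hE.1 i hi
  simpa [Real.dist_eq] using h _ this.1 _ this.2

lemma ii_of_loc {a : ℝ → ℝ} (ha : LocIntOn a) {s t : ℝ} (hs : 0 ≤ s) (ht : 0 ≤ t) :
    IntervalIntegrable a volume s t := by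
  rw [intervalIntegrable_iff]
  refine (ha (max s t) (le_max_of_le_left hs)).mono_set ?_
  intro x hx
  rw [uIoc, mem_Ioc] at hx
  exact ⟨(le_min hs ht).trans hx.1.le, hx.2⟩

/-- a function that is a primitive on `[0,∞)` is AC. -/
lemma ac_of_prim {f g : ℝ → ℝ} {c : ℝ} (hg : LocIntOn g)
    (hf : ∀ t, 0 ≤ t → f t = c + ∫ s in (0:ℝ)..t, g s) {s t : ℝ} (hs : 0 ≤ s) (ht : 0 ≤ t) :
    AbsolutelyContinuousOnInterval f s t := by
  have h1 : AbsolutelyContinuousOnInterval (fun x => ∫ v in (0:ℝ)..x, g v) 0 (max s t) :=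
    (ii_of_loc hg le_rfl (le_max_of_le_left hs)).absolutelyContinuousOnInterval_intervalIntegral
      (by simp)
  have h2 : AbsolutelyContinuousOnInterval (fun x => ∫ v in (0:ℝ)..x, g v) s t := by
    refine h1.mono ?_
    rw [uIcc_of_le (le_max_of_le_left hs : (0:ℝ) ≤ max s t)]
    intro x hx
    exact ⟨(le_min hs ht).trans hx.1, hx.2⟩
  refine ac_of_dom (C := 1) h2 ?_
  intro u hu v hv
  have hu0 : 0 ≤ u := (le_min hs ht).trans hu.1
  have hv0 : 0 ≤ v := (le_min hs ht).trans hv.1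
  rw [hf u hu0, hf v hv0]
  simp

lemma ae_deriv_of_prim {f g : ℝ → ℝ} {c : ℝ} (hg : LocIntOn g)
    (hf : ∀ t, 0 ≤ t → f t = c + ∫ s in (0:ℝ)..t, g s) :
    ∀ᵐ x, 0 ≤ x → 0 < x ∧ HasDerivAt f (g x) x := by
  have h1 : ∀ᵐ x : ℝ, ∀ n : ℕ, x ∈ uIcc (0:ℝ) n → ∀ c ∈ uIcc (0:ℝ) n,
      HasDerivAt (fun x => ∫ (t : ℝ) in c..x, g t) (g x) x := by
    rw [ae_all_iff]
    intro n
    exact (ii_of_loc hg le_rfl (Nat.cast_nonneg n)).ae_hasDerivAt_integral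
  have h0 : ∀ᵐ x : ℝ, x ≠ 0 := by simp [ae_iff, measure_singleton]
  filter_upwards [h1, h0] with x hx hx0 hxn
  have hpos : 0 < x := lt_of_le_of_ne hxn (Ne.symm hx0)
  refine ⟨hpos, ?_⟩
  obtain ⟨n, hn⟩ := exists_nat_ge x
  have h3 := hx n (by rw [uIcc_of_le (Nat.cast_nonneg n)]; exact ⟨hxn, hn⟩) 0 (by simp)
  refine (h3.const_add c).congr_of_eventuallyEq ?_
  filter_upwards [Ioi_mem_nhds hpos] with y hy
  exact hf y (le_of_lt hy)

lemma cont_of_prim {f g : ℝ → ℝ} {c : ℝ} (hg : LocIntOn g)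
    (hf : ∀ t, 0 ≤ t → f t = c + ∫ s in (0:ℝ)..t, g s) : ContinuousOn f (Ici 0) := by
  intro x hx
  have hx : (0:ℝ) ≤ x := hx
  have h := (ac_of_prim hg hf le_rfl (by linarith : (0:ℝ) ≤ x + 1)).continuousOn
  rw [uIcc_of_le (by linarith)] at h
  refine (h x ⟨hx, by linarith⟩).mono_of_mem_nhdsWithin ?_
  rw [mem_nhdsWithin]
  exact ⟨Iio (x+1), isOpen_Iio, by simp, fun y hy => ⟨hy.2, le_of_lt hy.1⟩⟩

lemma isSol_of_memS {a : ℝ → ℝ} {y₀ : ℝ} (hy₀ : 0 ≤ y₀) {w : ℝ → ℝ} (hw : MemS a y₀ w) :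
    IsSol a y₀ (fun t => (w t) ^ 2) := by
  obtain ⟨hn, g, hg, hwg, hga⟩ := hw
  refine ⟨(cont_of_prim hg hwg).pow 2, fun t _ => sq_nonneg _, fun t ht => ?_⟩
  have hac := ac_of_prim hg hwg le_rfl ht
  have h := hac.integral_deriv_mul_eq_sub hac
  have h0 : w 0 = Real.sqrt y₀ := by simpa using hwg 0 le_rfl
  have h1 : ∫ x in (0:ℝ)..t, deriv w x * w x + w x * deriv w x
      = ∫ x in (0:ℝ)..t, (-2) * (a x * Real.sqrt (w x ^ 2)) := by
    apply intervalIntegral.integral_congr_ae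
    filter_upwards [ae_deriv_of_prim hg hwg, hga] with x hx1 hx2 hx3
    rw [uIoc_of_le ht] at hx3
    have hx0 := hx3.1.le
    rw [(hx1 hx0).2.deriv, Real.sqrt_sq (hn x hx0)]
    rcases (hn x hx0).eq_or_lt with h | h
    · rw [← h]; simp
    · rw [hx2 hx0 h]; ring
  rw [h1, intervalIntegral.integral_const_mul, h0, Real.mul_self_sqrt hy₀] at h
  simp only
  nlinarith [h]

/-- The reflected path comparison data. -/
lemma exists_run {N : ℝ → ℝ} (hN : ContinuousOn N (Ici 0)) :
    ∃ L : ℝ → ℝ, ∀ t, 0 ≤ t → (∃ s ∈ Icc 0 t, L t = N s) ∧ ∀ s ∈ Icc 0 t, N s ≤ L t := by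
  have : ∀ t : ℝ, ∃ l : ℝ, 0 ≤ t → (∃ s ∈ Icc 0 t, l = N s) ∧ ∀ s ∈ Icc 0 t, N s ≤ l := by
    intro t
    by_cases ht : 0 ≤ t
    · obtain ⟨s, hs, hmax⟩ := isCompact_Icc.exists_isMaxOn (nonempty_Icc.2 ht)
        (hN.mono (Icc_subset_Ici_self : Icc 0 t ⊆ Ici 0))
      exact ⟨N s, fun _ => ⟨⟨s, hs, rfl⟩, fun r hr => hmax hr⟩⟩
    · exact ⟨0, fun h => absurd h ht⟩
  choose L hL using this
  exact ⟨L, hL⟩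

lemma upper {X L w : ℝ → ℝ} {c : ℝ} (hX : ContinuousOn X (Ici 0)) (hX0 : X 0 = c)
    (hL : ∀ t, 0 ≤ t → ∀ s ∈ Icc 0 t, max 0 (-X s) ≤ L t)
    (hw : ContinuousOn w (Ici 0)) (hn : ∀ t, 0 ≤ t → 0 ≤ w t) (hw0 : w 0 = c)
    (H : ∀ s t, 0 ≤ s → s ≤ t → (∀ r ∈ Icc s t, 0 < w r) → w t = w s + X t - X s)
    {t : ℝ} (ht : 0 ≤ t) : w t ≤ X t + L t := by
  by_cases hz : ∃ r ∈ Icc 0 t, w r = 0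
  · have hcl : IsCompact (Icc 0 t ∩ w ⁻¹' {0}) := by
      refine isCompact_Icc.of_isClosed_subset ?_ inter_subset_left
      exact (hw.mono Icc_subset_Ici_self).preimage_isClosed_of_isClosed isClosed_Icc
        isClosed_singleton
    obtain ⟨r, hr, hr0⟩ := hz
    obtain ⟨s, ⟨hs, hs0⟩, hmax⟩ := hcl.exists_isGreatest ⟨r, hr, hr0⟩
    have hs0 : w s = 0 := hs0
    have hLs := (le_max_right _ _).trans (hL t ht s hs)
    have key : w t - X t = w s - X s := by
      rcases hs.2.eq_or_lt with h | h
      · rw [h]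
      have hc : ContinuousWithinAt (fun x => w x - X x) (Ioi s) s :=
        ((hw.sub hX) s hs.1).mono (fun x hx => hs.1.trans (le_of_lt hx))
      have hc' : Tendsto (fun x => w x - X x) (𝓝[>] s) (𝓝 (w s - X s)) := hc
      refine tendsto_nhds_unique (tendsto_const_nhds.congr' ?_) hc'
      filter_upwards [Ioc_mem_nhdsGT h] with x hx
      have := H x t (hs.1.trans hx.1.le) hx.2 (fun q hq => by
        have hq0 : 0 ≤ q := (hs.1.trans hx.1.le).trans hq.1
        refine lt_of_le_of_ne (hn q hq0) fun h0 => ?_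
        have := hmax ⟨⟨hq0, hq.2⟩, h0.symm⟩
        have := hx.1; have := hq.1
        linarith)
      linarith
    linarith
  · push Not at hz
    have h1 := H 0 t le_rfl ht (fun r hr => lt_of_le_of_ne (hn r hr.1) (Ne.symm (hz r hr)))
    have h2 := (le_max_left _ _).trans (hL t ht 0 ⟨le_rfl, ht⟩)
    linarith

lemma H_memS {a w X : ℝ → ℝ} {y₀ : ℝ} (ha : LocIntOn a) (hw : MemS a y₀ w)
    (hX : ∀ t, 0 ≤ t → X t = Real.sqrt y₀ + ∫ s in (0:ℝ)..t, -a s)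
    (s t : ℝ) (hs : 0 ≤ s) (hst : s ≤ t) (hp : ∀ r ∈ Icc s t, 0 < w r) :
    w t = w s + X t - X s := by
  obtain ⟨hn, g, hg, hwg, hga⟩ := hw
  have ht := hs.trans hst
  have ha' : LocIntOn (fun x => -a x) := fun t ht => (ha t ht).neg
  have e1 : ∫ x in s..t, g x = ∫ x in s..t, -a x := by
    apply intervalIntegral.integral_congr_ae
    filter_upwards [hga] with x hx hx2
    rw [uIoc_of_le hst] at hx2
    exact hx (hs.trans hx2.1.le) (hp x ⟨hx2.1.le, hx2.2⟩)
  have e2 := intervalIntegral.integral_add_adjacent_intervals (ii_of_loc hg le_rfl hs)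
    (ii_of_loc hg hs ht)
  have e3 := intervalIntegral.integral_add_adjacent_intervals (ii_of_loc ha' le_rfl hs)
    (ii_of_loc ha' hs ht)
  rw [hX t ht, hX s hs, hwg t ht, hwg s hs, ← e2, ← e3, e1]
  ring

lemma H_isSol {a z X : ℝ → ℝ} {y₀ : ℝ} (ha : LocIntOn a) (hz : IsSol a y₀ z)
    (hX : ∀ t, 0 ≤ t → X t = Real.sqrt y₀ + ∫ s in (0:ℝ)..t, -a s)
    (s t : ℝ) (hs : 0 ≤ s) (hst : s ≤ t) (hp : ∀ r ∈ Icc s t, 0 < Real.sqrt (z r)) :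
    Real.sqrt (z t) = Real.sqrt (z s) + X t - X s := by
  obtain ⟨hc, hn, hzi⟩ := hz
  have ht := hs.trans hst
  have ha' : LocIntOn (fun x => -a x) := fun t ht => (ha t ht).neg
  have hsq : ContinuousOn (fun x => Real.sqrt (z x)) (Ici 0) := hc.sqrt
  have hg : LocIntOn (fun x => (-2) * (a x * Real.sqrt (z x))) := fun t ht =>
    ((ha t ht).mul_continuousOn (hsq.mono Icc_subset_Ici_self) isCompact_Icc).const_mul (-2)
  have hzg : ∀ t, 0 ≤ t → z t = y₀ + ∫ x in (0:ℝ)..t, (-2) * (a x * Real.sqrt (z x)) := by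
    intro t ht
    rw [intervalIntegral.integral_const_mul, hzi t ht]; ring
  have hacz := ac_of_prim hg hzg hs ht
  obtain ⟨r, hr, hmin⟩ := isCompact_Icc.exists_isMinOn (nonempty_Icc.2 hst)
    (hsq.mono (Icc_subset_Ici_self.trans (Ici_subset_Ici.2 hs) : Icc s t ⊆ Ici 0))
  have hm := hp r hr
  have hac : AbsolutelyContinuousOnInterval (fun x => Real.sqrt (z x)) s t := by
    refine ac_of_dom (C := 1 / Real.sqrt (z r)) hacz ?_
    rw [uIcc_of_le hst]
    intro u hu v hv
    have h1 : Real.sqrt (z r) ≤ Real.sqrt (z u) := hmin hu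
    have h2 : Real.sqrt (z r) ≤ Real.sqrt (z v) := hmin hv
    have e1 := Real.sq_sqrt (hn u (hs.trans hu.1))
    have e2 := Real.sq_sqrt (hn v (hs.trans hv.1))
    have e3 : z u - z v = (Real.sqrt (z u) - Real.sqrt (z v)) * (Real.sqrt (z u) + Real.sqrt (z v)) := by
      rw [← e1, ← e2]; simp; ring
    rw [e3, abs_mul, abs_of_pos (by linarith : 0 < Real.sqrt (z u) + Real.sqrt (z v)),
      div_mul_eq_mul_div, le_div_iff₀ hm, one_mul]
    exact mul_le_mul_of_nonneg_left (by linarith) (abs_nonneg _)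
  have hi := hac.integral_deriv_eq_sub
  have e1 : ∫ x in s..t, deriv (fun x => Real.sqrt (z x)) x = ∫ x in s..t, -a x := by
    apply intervalIntegral.integral_congr_ae
    filter_upwards [ae_deriv_of_prim hg hzg] with x hx hx2
    rw [uIoc_of_le hst] at hx2
    have hpx := hp x ⟨hx2.1.le, hx2.2⟩
    have hd := (hx (hs.trans hx2.1.le)).2.sqrt (Real.sqrt_pos.1 hpx).ne'
    rw [hd.deriv]
    field_simp
  have e3 := intervalIntegral.integral_add_adjacent_intervals (ii_of_loc ha' le_rfl hs)
    (ii_of_loc ha' hs ht)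
  rw [hX t ht, hX s hs, ← e3, ← e1, hi]
  ring

lemma R_memS {a X L : ℝ → ℝ} {y₀ : ℝ} (ha : LocIntOn a)
    (hX : ∀ t, 0 ≤ t → X t = Real.sqrt y₀ + ∫ s in (0:ℝ)..t, -a s)
    (hL : ∀ t, 0 ≤ t → (∃ s ∈ Icc 0 t, L t = max 0 (-X s)) ∧
      ∀ s ∈ Icc 0 t, max 0 (-X s) ≤ L t) :
    MemS a y₀ (fun t => X t + L t) := by
  have ha' : LocIntOn (fun x => -a x) := fun t ht => (ha t ht).neg
  have habs : LocIntOn (fun x => |a x|) := fun t ht => (ha t ht).abs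
  have hXc := cont_of_prim ha' hX
  have hmono : ∀ u v, 0 ≤ u → u ≤ v → L u ≤ L v := by
    intro u v hu huv
    obtain ⟨q, hq, hq'⟩ := (hL u hu).1
    rw [hq']
    exact (hL v (hu.trans huv)).2 q ⟨hq.1, hq.2.trans huv⟩
  set G : ℝ → ℝ := fun t => ∫ s in (0:ℝ)..t, |a s| with hG
  have hGX : ∀ u v, 0 ≤ u → u ≤ v → |X v - X u| ≤ G v - G u := by
    intro u v hu huv
    have hv := hu.trans huv
    have e2 := intervalIntegral.integral_add_adjacent_intervals (ii_of_loc habs le_rfl hu)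
      (ii_of_loc habs hu hv)
    have e3 := intervalIntegral.integral_add_adjacent_intervals (ii_of_loc ha' le_rfl hu)
      (ii_of_loc ha' hu hv)
    have e4 := intervalIntegral.norm_integral_le_integral_norm (f := fun x => -a x) (μ := volume) huv
    simp only [norm_neg, Real.norm_eq_abs] at e4
    have e5 : X v - X u = ∫ x in u..v, -a x := by rw [hX v hv, hX u hu, ← e3]; ring
    have e6 : G v - G u = ∫ x in u..v, |a x| := by simp only [hG]; rw [← e2]; ring
    rw [e5, e6]; exact e4
  have hLG : ∀ u v, 0 ≤ u → u ≤ v → L v - L u ≤ G v - G u := by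
    intro u v hu huv
    have hG0 := (abs_nonneg _).trans (hGX u v hu huv)
    obtain ⟨q, hq, hq'⟩ := (hL v (hu.trans huv)).1
    rcases le_total q u with h | h
    · have := (hL u hu).2 q ⟨hq.1, h⟩
      linarith
    · have h1 := hGX u q hu h
      have h2 := (abs_nonneg _).trans (hGX q v hq.1 hq.2)
      have h3 := (hL u hu).2 u ⟨hu, le_rfl⟩
      have h4 := le_max_left 0 (-X u)
      have h5 := le_max_right 0 (-X u)
      have h6 := neg_abs_le (X q - X u)
      have : max 0 (-X q) ≤ L u + (G v - G u) := max_le (by linarith) (by linarith)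
      linarith
  have hacG : ∀ t, 0 ≤ t → AbsolutelyContinuousOnInterval G 0 t := fun t ht =>
    ac_of_prim (c := 0) habs (fun t _ => by simp [hG]) le_rfl ht
  have hacL : ∀ t, 0 ≤ t → AbsolutelyContinuousOnInterval L 0 t := by
    intro t ht
    refine ac_of_dom (C := 1) (hacG t ht) ?_
    rw [uIcc_of_le ht]
    have main : ∀ u v, 0 ≤ u → u ≤ v → |L v - L u| ≤ |G v - G u| := by
      intro u v hu huv
      rw [abs_of_nonneg (sub_nonneg.2 (hmono u v hu huv))]
      exact (hLG u v hu huv).trans (le_abs_self _)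
    intro u hu v hv
    rw [one_mul]
    rcases le_total u v with h | h
    · rw [abs_sub_comm, abs_sub_comm (G u)]; exact main u v hu.1 h
    · exact main v u hv.1 h
  have hacR : ∀ t, 0 ≤ t → AbsolutelyContinuousOnInterval (fun t => X t + L t) 0 t :=
    fun t ht => (ac_of_prim ha' hX le_rfl ht).fun_add (hacL t ht)
  have hLs : ∀ t, 0 ≤ t → -X t ≤ L t := fun t ht =>
    (le_max_right _ _).trans ((hL t ht).2 t ⟨ht, le_rfl⟩)
  have hL0 : ∀ t, 0 ≤ t → 0 ≤ L t := fun t ht =>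
    (le_max_left _ _).trans ((hL t ht).2 t ⟨ht, le_rfl⟩)
  refine ⟨fun t ht => by linarith [hLs t ht], deriv (fun t => X t + L t), ?_, ?_, ?_⟩
  · intro t ht
    have := (hacR t ht).intervalIntegrable_deriv
    rwa [intervalIntegrable_iff_integrableOn_Icc_of_le ht] at this
  · intro t ht
    rw [(hacR t ht).integral_deriv_eq_sub]
    have hX0 : X 0 = Real.sqrt y₀ := by simpa using hX 0 le_rfl
    obtain ⟨q, hq, hq'⟩ := (hL 0 le_rfl).1
    have hq0 : q = 0 := le_antisymm hq.2 hq.1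
    rw [hq0, hX0, max_eq_left (by linarith [Real.sqrt_nonneg y₀])] at hq'
    simp only [hq', hX0]; ring
  · filter_upwards [ae_deriv_of_prim ha' hX] with s hs hs0 hpos
    obtain ⟨hsp, hd⟩ := hs hs0
    have hpos : 0 < X s + L s := hpos
    obtain ⟨c, hc1, hc2⟩ := exists_between (by linarith : -X s < L s)
    have hXs : ContinuousAt X s := hXc.continuousAt (Ici_mem_nhds hsp)
    have hLc : ContinuousAt L s := by
      have := (hacL (s+1) (by linarith)).continuousOn
      rw [uIcc_of_le (by linarith)] at this
      exact this.continuousAt (Icc_mem_nhds hsp (by linarith))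
    have ev : ∀ᶠ u in 𝓝 s, 0 < u ∧ -X u < c ∧ c < L u :=
      (lt_mem_nhds hsp).and ((hXs.neg.eventually (gt_mem_nhds hc1)).and
        (hLc.eventually (lt_mem_nhds hc2)))
    obtain ⟨ε, hε, hball⟩ := Metric.eventually_nhds_iff_ball.1 ev
    have hconst : ∀ u v, u ∈ Metric.ball s ε → v ∈ Metric.ball s ε → u ≤ v → L v ≤ L u := by
      intro u v hu hv huv
      have hu0 := (hball u hu).1.le
      obtain ⟨q, hq, hq'⟩ := (hL v (hu0.trans huv)).1
      rcases le_total q u with h | h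
      · rw [hq']; exact (hL u hu0).2 q ⟨hq.1, h⟩
      · have hqb : q ∈ Metric.ball s ε := by
          rw [Real.ball_eq_Ioo] at hu hv ⊢
          exact ⟨hu.1.trans_le h, hq.2.trans_lt hv.2⟩
        have h1 := (hball q hqb).2.1
        have h2 := (hball v hv).2.2
        rcases max_choice 0 (-X q) with h3 | h3
        · rw [hq', h3]; exact hL0 u hu0
        · rw [h3] at hq'; linarith
    have hLd : HasDerivAt L 0 s := by
      refine (hasDerivAt_const s (L s)).congr_of_eventuallyEq ?_
      filter_upwards [Metric.ball_mem_nhds s hε] with u hu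
      have hss := Metric.mem_ball_self hε (x := s)
      have hu0 := (hball u hu).1.le
      rcases le_total u s with h | h
      · exact le_antisymm (hmono u s hu0 h) (hconst u s hu hss h)
      · exact le_antisymm (hconst s u hss hu h) (hmono s u hs0 h)
    simpa using (hd.fun_add hLd).deriv

theorem stmt1 (a : ℝ → ℝ) (y₀ : ℝ) (ha : LocIntOn a) (hy₀ : 0 ≤ y₀)
    (M : ℝ → ℝ) (hM : ∀ t : ℝ, M t = sSup {x : ℝ | ∃ w : ℝ → ℝ, MemS a y₀ w ∧ w t = x}) :
    MemS a y₀ M ∧ IsSol a y₀ (fun t => (M t) ^ 2) ∧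
      ∀ z : ℝ → ℝ, IsSol a y₀ z → ∀ t : ℝ, 0 ≤ t → z t ≤ (M t) ^ 2 := by
  have ha' : LocIntOn (fun x => -a x) := fun t ht => (ha t ht).neg
  obtain ⟨X, hX⟩ : ∃ X : ℝ → ℝ, ∀ t, 0 ≤ t → X t = Real.sqrt y₀ + ∫ s in (0:ℝ)..t, -a s :=
    ⟨_, fun _ _ => rfl⟩
  have hXc := cont_of_prim ha' hX
  have hX0 : X 0 = Real.sqrt y₀ := by simpa using hX 0 le_rfl
  obtain ⟨L, hL⟩ := exists_run (N := fun s => max 0 (-X s)) (continuousOn_const.sup hXc.neg)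
  have hR := R_memS ha hX hL
  have hub : ∀ w, MemS a y₀ w → ∀ t, 0 ≤ t → w t ≤ X t + L t := by
    intro w hw t ht
    have hwc : ContinuousOn w (Ici 0) := by
      obtain ⟨_, g, hg, hwg, _⟩ := hw
      exact cont_of_prim hg hwg
    have hw0 : w 0 = Real.sqrt y₀ := by
      obtain ⟨_, g, hg, hwg, _⟩ := hw
      simpa using hwg 0 le_rfl
    exact upper hXc hX0 (fun t ht => (hL t ht).2) hwc hw.1 hw0 (H_memS ha hw hX) ht
  have hMR : ∀ t, 0 ≤ t → M t = X t + L t := by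
    intro t ht
    rw [hM t]
    refine IsGreatest.csSup_eq ⟨⟨_, hR, rfl⟩, ?_⟩
    rintro x ⟨w, hw, rfl⟩
    exact hub w hw t ht
  have hMS : MemS a y₀ M := by
    obtain ⟨hn, g, hg, hwg, hga⟩ := hR
    refine ⟨fun t ht => by rw [hMR t ht]; exact hn t ht, g, hg,
      fun t ht => by rw [hMR t ht]; exact hwg t ht, ?_⟩
    filter_upwards [hga] with s hs hs0 hp
    rw [hMR s hs0] at hp
    exact hs hs0 hp
  refine ⟨hMS, isSol_of_memS hy₀ hMS, fun z hz t ht => ?_⟩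
  have hz0 : z 0 = y₀ := by simpa using hz.2.2 0 le_rfl
  have h1 : Real.sqrt (z t) ≤ X t + L t :=
    upper (w := fun x => Real.sqrt (z x)) hXc hX0 (fun t ht => (hL t ht).2) hz.1.sqrt
      (fun t _ => Real.sqrt_nonneg _) (by simp [hz0]) (H_isSol ha hz hX) ht
  rw [hMR t ht, ← Real.sq_sqrt (hz.2.1 t ht)]
  exact pow_le_pow_left₀ (Real.sqrt_nonneg _) h1 2
end

section
/- For i = 1, 2, let aᵢ: [0,∞) → ℝ be locally integrable, let y₀ ≥ 0, and let yᵢ be the maximal solution of the Cauchy problem y' + 2aᵢ√y = 0, y(0) = y₀. Then the function t ↦ |√(y₁(t)) − √(y₂(t))| admits an integral representation |√(y₁(t)) − √(y₂(t))| = ∫₀ᵗ h(s) ds for every t ≥ 0, for some locally integrable function h satisfying h(s) ≤ |a₁(s) − a₂(s)| for almost every s ≥ 0. -/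
open MeasureTheory Set Filter

open Topology
lemma ac_dom {f G : ℝ → ℝ} {p q C : ℝ} (hpq : p ≤ q)
    (hG : AbsolutelyContinuousOnInterval G p q)
    (h : ∀ u v, p ≤ u → u ≤ v → v ≤ q → |f v - f u| ≤ C * |G v - G u|) :
    AbsolutelyContinuousOnInterval f p q := by
  have h' : ∀ u ∈ Icc p q, ∀ v ∈ Icc p q, dist (f u) (f v) ≤ C * dist (G u) (G v) := by
    intro u hu v hv
    rcases le_total u v with huv | huv
    · have := h u v hu.1 huv hv.2
      rwa [dist_comm, dist_comm (G u), Real.dist_eq, Real.dist_eq]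
    · have := h v u hv.1 huv hu.2
      rwa [Real.dist_eq, Real.dist_eq]
  unfold AbsolutelyContinuousOnInterval at hG ⊢
  have h0 := hG.const_mul C
  rw [mul_zero] at h0
  refine squeeze_zero' (Eventually.of_forall fun E => Finset.sum_nonneg fun i _ => dist_nonneg)
    ?_ h0
  refine Filter.Eventually.filter_mono inf_le_right ?_
  rw [eventually_principal]
  intro E hE
  rw [Finset.mul_sum]
  apply Finset.sum_le_sum
  intro i hi
  have := hE.1 i hi
  rw [uIcc_of_le hpq] at this
  exact h' _ this.1 _ this.2

lemma locInt_indicator {a : ℝ → ℝ} (ha : LocIntOn a) :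
    LocallyIntegrable ((Ici (0:ℝ)).indicator a) volume := by
  rw [locallyIntegrable_iff]
  intro K hK
  obtain ⟨R, hR⟩ := hK.isBounded.subset_closedBall 0
  rw [IntegrableOn, integrable_indicator_iff measurableSet_Ici, IntegrableOn,
    Measure.restrict_restrict measurableSet_Ici]
  refine (ha (max R 0) (le_max_right _ _)).mono_set ?_
  rintro x ⟨hx0, hxK⟩
  have := hR hxK
  rw [Metric.mem_closedBall, Real.dist_eq, sub_zero] at this
  exact ⟨hx0, (le_abs_self x).trans (this.trans (le_max_left _ _))⟩

lemma isSol_indicator {a : ℝ → ℝ} {y₀ : ℝ} {y : ℝ → ℝ} :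
    IsSol ((Ici (0:ℝ)).indicator a) y₀ y ↔ IsSol a y₀ y := by
  unfold IsSol
  refine and_congr_right fun _ => and_congr_right fun _ => forall_congr' fun t =>
    forall_congr' fun ht => ?_
  have : ∫ s in (0:ℝ)..t, (Ici (0:ℝ)).indicator a s * Real.sqrt (y s)
      = ∫ s in (0:ℝ)..t, a s * Real.sqrt (y s) := by
    apply intervalIntegral.integral_congr
    intro s hs
    rw [uIcc_of_le ht] at hs
    simp only
    rw [indicator_of_mem (show s ∈ Ici (0:ℝ) from hs.1)]
  rw [this]

/-- primitive -/
noncomputable def prim (a : ℝ → ℝ) (t : ℝ) : ℝ := ∫ s in (0:ℝ)..t, a s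

/-- running maximum -/
noncomputable def runMax (a : ℝ → ℝ) (c t : ℝ) : ℝ := sSup (insert c (Set.image (prim a) (Icc 0 t)))

lemma ii {a : ℝ → ℝ} (ha : LocallyIntegrable a volume) (p q : ℝ) :
    IntervalIntegrable a volume p q :=
  (ha.integrableOn_isCompact isCompact_uIcc).intervalIntegrable

lemma li_abs {a : ℝ → ℝ} (ha : LocallyIntegrable a volume) :
    LocallyIntegrable (fun x => |a x|) volume := fun x => by
  obtain ⟨s, hs, h⟩ := ha x
  exact ⟨s, hs, h.abs⟩

lemma prim_ac {a : ℝ → ℝ} (ha : LocallyIntegrable a volume) {p q : ℝ} (hp : 0 ≤ p) (hpq : p ≤ q) :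
    AbsolutelyContinuousOnInterval (prim a) p q := by
  have := (ii ha 0 q).absolutelyContinuousOnInterval_intervalIntegral (c := 0) (by simp)
  exact this.mono (by rw [uIcc_of_le hpq, uIcc_of_le (hp.trans hpq)]; exact Icc_subset_Icc_left hp)

lemma prim_cont {a : ℝ → ℝ} (ha : LocallyIntegrable a volume) : Continuous (prim a) :=
  intervalIntegral.continuous_primitive (ii ha) 0

lemma prim_sub {a : ℝ → ℝ} (ha : LocallyIntegrable a volume) (s t : ℝ) :
    prim a t - prim a s = ∫ x in s..t, a x :=
  intervalIntegral.integral_interval_sub_left (ii ha 0 t) (ii ha 0 s)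

lemma prim_abs {a : ℝ → ℝ} (ha : LocallyIntegrable a volume) {s t : ℝ} (hst : s ≤ t) :
    |prim a t - prim a s| ≤ prim (fun x => |a x|) t - prim (fun x => |a x|) s := by
  rw [prim_sub ha, prim_sub (li_abs ha)]
  exact intervalIntegral.abs_integral_le_integral_abs hst

lemma prim_mono {a : ℝ → ℝ} (ha : LocallyIntegrable a volume) {s t : ℝ} (hst : s ≤ t) :
    prim (fun x => |a x|) s ≤ prim (fun x => |a x|) t := by
  have := (abs_nonneg _).trans (prim_abs ha hst)
  linarith

lemma runMax_lub {a : ℝ → ℝ} (ha : LocallyIntegrable a volume) (c t : ℝ) :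
    IsLUB (insert c (Set.image (prim a) (Icc 0 t))) (runMax a c t) := by
  refine isLUB_csSup (insert_nonempty _ _) ?_
  exact (isCompact_Icc.image (prim_cont ha)).bddAbove.insert c

lemma c_le_runMax {a : ℝ → ℝ} (ha : LocallyIntegrable a volume) (c t : ℝ) : c ≤ runMax a c t :=
  (runMax_lub ha c t).1 (mem_insert _ _)

lemma le_runMax {a : ℝ → ℝ} (ha : LocallyIntegrable a volume) (c : ℝ) {r t : ℝ} (h0 : 0 ≤ r)
    (hr : r ≤ t) : prim a r ≤ runMax a c t :=
  (runMax_lub ha c t).1 (mem_insert_of_mem _ ⟨r, ⟨h0, hr⟩, rfl⟩)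

lemma runMax_le {a : ℝ → ℝ} (ha : LocallyIntegrable a volume) {c t x : ℝ} (hc : c ≤ x)
    (h : ∀ r, 0 ≤ r → r ≤ t → prim a r ≤ x) : runMax a c t ≤ x := by
  apply (runMax_lub ha c t).2
  rintro _ (rfl | ⟨r, hr, rfl⟩)
  · exact hc
  · exact h r hr.1 hr.2

lemma runMax_step {a : ℝ → ℝ} (ha : LocallyIntegrable a volume) {c s t x : ℝ}
    (hc : runMax a c s ≤ x)
    (h : ∀ r, s ≤ r → r ≤ t → prim a r ≤ x) : runMax a c t ≤ x := by
  apply runMax_le ha ((c_le_runMax ha c s).trans hc)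
  intro r h0 hr
  rcases le_total s r with h1 | h1
  · exact h r h1 hr
  · exact (le_runMax ha c h0 h1).trans hc

lemma runMax_mono {a : ℝ → ℝ} (ha : LocallyIntegrable a volume) {c s t : ℝ} (hst : s ≤ t) :
    runMax a c s ≤ runMax a c t :=
  runMax_le ha (c_le_runMax ha c t) fun r h0 hr => le_runMax ha c h0 (hr.trans hst)

lemma runMax_ac {a : ℝ → ℝ} (ha : LocallyIntegrable a volume) {c p q : ℝ} (hp : 0 ≤ p)
    (hpq : p ≤ q) : AbsolutelyContinuousOnInterval (runMax a c) p q := by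
  refine ac_dom (C := 1) hpq (prim_ac (li_abs ha) hp hpq) ?_
  intro u v hu huv hv
  rw [abs_of_nonneg (sub_nonneg.2 (runMax_mono ha huv)), one_mul,
    abs_of_nonneg (sub_nonneg.2 (prim_mono ha huv)), sub_le_iff_le_add]
  refine runMax_step ha (s := u) (by linarith [prim_mono ha huv]) ?_
  intro r hr hrv
  have h1 := le_runMax ha c (hp.trans hu) le_rfl
  have h2 := (le_abs_self _).trans (prim_abs ha hr)
  have h3 := prim_mono ha hrv
  linarith

/-- reflected process -/
noncomputable def skor (a : ℝ → ℝ) (c t : ℝ) : ℝ := runMax a c t - prim a t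

lemma skor_ac {a : ℝ → ℝ} (ha : LocallyIntegrable a volume) {c p q : ℝ} (hp : 0 ≤ p)
    (hpq : p ≤ q) : AbsolutelyContinuousOnInterval (skor a c) p q :=
  (runMax_ac ha hp hpq).sub (prim_ac ha hp hpq)

lemma skor_nonneg {a : ℝ → ℝ} (ha : LocallyIntegrable a volume) {c t : ℝ} (ht : 0 ≤ t) :
    0 ≤ skor a c t := sub_nonneg.2 (le_runMax ha c ht le_rfl)

lemma skor_zero {a : ℝ → ℝ} (ha : LocallyIntegrable a volume) {c : ℝ} (hc : 0 ≤ c) :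
    skor a c 0 = c := by
  have h0 : prim a 0 = 0 := by simp [prim]
  have : runMax a c 0 = c := by
    apply le_antisymm _ (c_le_runMax ha c 0)
    apply runMax_le ha le_rfl
    intro r h1 h2
    rw [le_antisymm h2 h1, h0]; exact hc
  rw [skor, this, h0, sub_zero]

lemma skor_contr {a b : ℝ → ℝ} (ha : LocallyIntegrable a volume) (hb : LocallyIntegrable b volume)
    {c s t : ℝ} (hs : 0 ≤ s) (hst : s ≤ t) :
    skor a c t - skor b c t ≤ |skor a c s - skor b c s| +
      (prim (fun x => |a x - b x|) t - prim (fun x => |a x - b x|) s) := by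
  have hab : LocallyIntegrable (fun x => a x - b x) volume := ha.sub hb
  have hp : ∀ r, prim (fun x => a x - b x) r = prim a r - prim b r := fun r =>
    intervalIntegral.integral_sub (ii ha 0 r) (ii hb 0 r)
  have key : ∀ r, s ≤ r → r ≤ t → (prim a r - prim b r) - (prim a t - prim b t) ≤
      prim (fun x => |a x - b x|) t - prim (fun x => |a x - b x|) s := by
    intro r h1 h2
    have h3 := (neg_le_abs _).trans (prim_abs hab h2)
    have h4 := prim_mono hab h1
    rw [hp, hp] at h3
    linarith
  have h5 : runMax a c t ≤ prim a t + skor b c t + |skor a c s - skor b c s| +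
      (prim (fun x => |a x - b x|) t - prim (fun x => |a x - b x|) s) := by
    refine runMax_step ha (s := s) ?_ ?_
    · have h1 := le_abs_self (skor a c s - skor b c s)
      have h2 := runMax_mono hb (c := c) hst
      have h3 := key s le_rfl hst
      unfold skor at *
      linarith
    · intro r h1 h2
      have h3 := key r h1 h2
      have h4 := abs_nonneg (skor a c s - skor b c s)
      have h5 := le_runMax hb c (hs.trans h1) h2
      unfold skor at *
      linarith
  unfold skor at *
  linarith

lemma skor_hasDerivAt {a : ℝ → ℝ} (ha : LocallyIntegrable a volume) {c x : ℝ}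
    (hx : 0 < skor a c x) (hd : HasDerivAt (prim a) (a x) x) :
    HasDerivAt (skor a c) (-a x) x := by
  have hM : runMax a c =ᶠ[𝓝 x] fun _ => runMax a c x := by
    have h1 : ∀ᶠ r in 𝓝 x, prim a r < runMax a c x - skor a c x / 2 := by
      apply (prim_cont ha).continuousAt.eventually_lt continuousAt_const
      unfold skor at *; linarith
    obtain ⟨δ, hδ, h2⟩ := Metric.eventually_nhds_iff.1 h1
    refine Metric.eventually_nhds_iff.2 ⟨δ, hδ, fun u hu => ?_⟩
    rw [Real.dist_eq, abs_lt] at hu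
    rcases le_total u x with hux | hux
    · apply le_antisymm (runMax_mono ha hux)
      have : runMax a c x ≤ max (runMax a c u) (runMax a c x - skor a c x / 2) := by
        refine runMax_step ha (s := u) (le_max_left _ _) fun r h3 h4 => le_max_of_le_right ?_
        refine (h2 ?_).le
        rw [Real.dist_eq, abs_lt]; constructor <;> linarith
      rcases le_max_iff.1 this with h | h
      · exact h
      · linarith
    · apply le_antisymm _ (runMax_mono ha hux)
      refine runMax_step ha (s := x) le_rfl fun r h3 h4 => ?_
      have : prim a r < _ := h2 (y := r) (by
        rw [Real.dist_eq, abs_lt]; constructor <;> linarith)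
      linarith
  have h2 : HasDerivAt (runMax a c) 0 x := (hasDerivAt_const x _).congr_of_eventuallyEq hM
  have := h2.sub hd
  rwa [zero_sub] at this

lemma prim_ae {a : ℝ → ℝ} (ha : LocallyIntegrable a volume) :
    ∀ᵐ x, HasDerivAt (prim a) (a x) x := by
  filter_upwards [_root_.LocallyIntegrable.ae_hasDerivAt_integral ha] with x hx using hx 0

lemma skor_isSol {a : ℝ → ℝ} (ha : LocallyIntegrable a volume) {y₀ : ℝ} (hy : 0 ≤ y₀) :
    IsSol a y₀ (fun t => skor a (Real.sqrt y₀) t ^ 2) := by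
  set c := Real.sqrt y₀
  have hc : 0 ≤ c := Real.sqrt_nonneg _
  refine ⟨?_, fun t _ => sq_nonneg _, ?_⟩
  · intro t ht
    have h1 := (skor_ac ha (c := c) le_rfl (show (0:ℝ) ≤ t + 1 by linarith [mem_Ici.1 ht])).continuousOn
    rw [uIcc_of_le (by linarith [mem_Ici.1 ht])] at h1
    have h2 := (h1.pow 2) t ⟨ht, by linarith⟩
    refine h2.mono_of_mem_nhdsWithin ?_
    rw [← Ici_inter_Iic]
    exact inter_mem_nhdsWithin _ (Iic_mem_nhds (by linarith))
  · intro t ht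
    have hac := skor_ac ha (c := c) le_rfl ht
    have h1 := hac.integral_deriv_mul_eq_sub hac
    have h2 : ∫ x in (0:ℝ)..t, deriv (skor a c) x * skor a c x + skor a c x * deriv (skor a c) x
        = ∫ x in (0:ℝ)..t, (-2) * (a x * Real.sqrt (skor a c x ^ 2)) := by
      apply intervalIntegral.integral_congr_ae
      filter_upwards [prim_ae ha] with x hx hxt
      rw [uIoc_of_le ht] at hxt
      have h3 := skor_nonneg ha (c := c) hxt.1.le
      rw [Real.sqrt_sq h3]
      rcases h3.eq_or_lt with h | h
      · rw [← h]; simp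
      · rw [(skor_hasDerivAt ha h hx).deriv]; ring
    rw [h2, intervalIntegral.integral_const_mul, skor_zero ha hc] at h1
    have : c * c = y₀ := Real.mul_self_sqrt hy
    simp only
    linarith

lemma sol_const {a : ℝ → ℝ} (ha : LocallyIntegrable a volume) {y₀ : ℝ} {y : ℝ → ℝ}
    (hy : IsSol a y₀ y) {p q : ℝ} (hp : 0 ≤ p) (hpq : p ≤ q) (hpos : ∀ x ∈ Icc p q, 0 < y x) :
    Real.sqrt (y p) + prim a p = Real.sqrt (y q) + prim a q := by
  obtain ⟨hc, hnn, hint⟩ := hy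
  have hq : 0 ≤ q := hp.trans hpq
  have hI : IntervalIntegrable (fun s => a s * Real.sqrt (y s)) volume 0 (q + 1) := by
    apply (ii ha 0 (q+1)).mul_continuousOn
    rw [uIcc_of_le (by linarith)]
    exact (hc.mono Icc_subset_Ici_self).sqrt
  have hY := hI.absolutelyContinuousOnInterval_intervalIntegral (c := 0) (by simp)
  replace hY := hY.mono (c := p) (d := q) (by
    rw [uIcc_of_le hpq, uIcc_of_le (by linarith)]; exact Icc_subset_Icc hp (by linarith))
  obtain ⟨x₀, hx₀, hmin⟩ := isCompact_Icc.exists_isMinOn (nonempty_Icc.2 hpq)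
    (hc.mono (fun x hx => hp.trans hx.1) : ContinuousOn y (Icc p q))
  have hm := hpos x₀ hx₀
  have hsm : 0 < Real.sqrt (y x₀) := Real.sqrt_pos.2 hm
  have hac : AbsolutelyContinuousOnInterval (fun t => Real.sqrt (y t)) p q := by
    refine ac_dom (C := 2 / Real.sqrt (y x₀)) hpq hY ?_
    intro u v hu huv hv
    have e : y v - y u = -2 * ((∫ s in (0:ℝ)..v, a s * Real.sqrt (y s)) -
        ∫ s in (0:ℝ)..u, a s * Real.sqrt (y s)) := by
      rw [hint v (by linarith), hint u (by linarith)]; ring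
    have hu' := Real.mul_self_sqrt (hnn u (by linarith))
    have hv' := Real.mul_self_sqrt (hnn v (by linarith))
    have hum : Real.sqrt (y x₀) ≤ Real.sqrt (y u) := Real.sqrt_le_sqrt (hmin ⟨hu, by linarith⟩)
    have hvm := Real.sqrt_nonneg (y v)
    have e2 : |y v - y u| = |Real.sqrt (y v) - Real.sqrt (y u)| *
        (Real.sqrt (y v) + Real.sqrt (y u)) := by
      rw [← abs_of_nonneg (show 0 ≤ Real.sqrt (y v) + Real.sqrt (y u) by linarith), ← abs_mul]
      congr 1; linarith
    rw [div_mul_eq_mul_div, le_div_iff₀ hsm]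
    have e3 := congrArg abs e
    rw [abs_mul, abs_neg, abs_two] at e3
    rw [← e3, e2]
    apply mul_le_mul_of_nonneg_left _ (abs_nonneg _)
    linarith
  have hφ := (hac.fun_add (prim_ac ha hp hpq)).integral_deriv_eq_sub
  have h0 : ∫ x in p..q, deriv (fun t => Real.sqrt (y t) + prim a t) x = ∫ x in p..q, (0:ℝ) := by
    apply intervalIntegral.integral_congr_ae
    filter_upwards [prim_ae ha, hI.ae_hasDerivAt_integral] with x hx hx2 hxt
    rw [uIoc_of_le hpq] at hxt
    have hx0 : 0 < x := hp.trans_lt hxt.1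
    rw [uIcc_of_le (by linarith)] at hx2
    have h1 := hx2 ⟨hx0.le, by linarith [hxt.2]⟩ 0 ⟨le_rfl, by linarith⟩
    have h2 : HasDerivAt y (-(2 * (a x * Real.sqrt (y x)))) x := by
      refine ((h1.const_mul 2).const_sub y₀).congr_of_eventuallyEq ?_
      filter_upwards [Ioi_mem_nhds hx0] with u hu using hint u (le_of_lt hu)
    have hyx := hpos x ⟨hxt.1.le, hxt.2⟩
    have h3 := (h2.sqrt hyx.ne').add hx
    have := h3.deriv
    have hs := Real.sqrt_pos.2 hyx
    refine this.trans ?_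
    field_simp
    ring
  rw [h0] at hφ
  simp at hφ
  linarith

lemma sol_le {a : ℝ → ℝ} (ha : LocallyIntegrable a volume) {y₀ : ℝ} {y : ℝ → ℝ}
    (hy : IsSol a y₀ y) {t : ℝ} (ht : 0 ≤ t) :
    Real.sqrt (y t) ≤ skor a (Real.sqrt y₀) t := by
  have hy' := hy
  obtain ⟨hc, hnn, hint⟩ := hy'
  have hy0 : y 0 = y₀ := by simpa using hint 0 le_rfl
  suffices h : Real.sqrt (y t) + prim a t ≤ runMax a (Real.sqrt y₀) t by unfold skor; linarith
  by_cases hz : ∃ x ∈ Icc 0 t, y x = 0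
  · have hZc : IsCompact (Icc 0 t ∩ Set.preimage y {0}) := by
      apply isCompact_Icc.of_isClosed_subset _ inter_subset_left
      exact (hc.mono Icc_subset_Ici_self).preimage_isClosed_of_isClosed isClosed_Icc
        isClosed_singleton
    obtain ⟨z, hz1, hz2⟩ := hz
    obtain ⟨s, ⟨hs1, hs2⟩, hs3⟩ := hZc.exists_isGreatest ⟨z, hz1, hz2⟩
    have hs2 : y s = 0 := hs2
    have hφ : Real.sqrt (y s) + prim a s = Real.sqrt (y t) + prim a t := by
      rcases hs1.2.eq_or_lt with h | hst
      · rw [h]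
      have hpos : ∀ x, s < x → x ≤ t → 0 < y x := by
        intro x h1 h2
        have hx0 : 0 ≤ x := hs1.1.trans h1.le
        refine (hnn x hx0).lt_of_ne' fun h => ?_
        exact absurd (hs3 ⟨⟨hx0, h2⟩, h⟩) (not_le.2 h1)
      have hcont : ContinuousWithinAt (fun u => Real.sqrt (y u) + prim a u) (Ioi s) s := by
        refine ContinuousWithinAt.add ?_ (prim_cont ha).continuousWithinAt
        exact ((hc s hs1.1).mono (Ioi_subset_Ici hs1.1)).sqrt
      refine tendsto_nhds_unique hcont.tendsto (tendsto_const_nhds.congr' ?_)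
      filter_upwards [Ioc_mem_nhdsGT hst] with u hu
      exact (sol_const ha hy (hs1.1.trans hu.1.le) hu.2
        fun x hx => hpos x (hu.1.trans_le hx.1) hx.2).symm
    rw [← hφ, hs2, Real.sqrt_zero, zero_add]
    exact le_runMax ha _ hs1.1 hs1.2
  · push Not at hz
    have h := sol_const ha hy le_rfl ht fun x hx => (hnn x hx.1).lt_of_ne' (hz x hx)
    have h0 : prim a 0 = 0 := by simp [prim]
    rw [← h, hy0, h0, add_zero]
    exact c_le_runMax ha _ _

lemma sqrt_maxSol {a : ℝ → ℝ} (ha : LocIntOn a) {y₀ : ℝ} (hy₀ : 0 ≤ y₀) {y : ℝ → ℝ}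
    (hy : IsMaxSol a y₀ y) {t : ℝ} (ht : 0 ≤ t) :
    Real.sqrt (y t) = skor ((Ici (0:ℝ)).indicator a) (Real.sqrt y₀) t := by
  have hl := locInt_indicator ha
  apply le_antisymm (sol_le hl (isSol_indicator.2 hy.1) ht)
  apply Real.le_sqrt_of_sq_le
  exact hy.2 _ (isSol_indicator.1 (skor_isSol hl hy₀)) t ht

theorem stmt4 (a₁ a₂ : ℝ → ℝ) (y₀ : ℝ) (ha₁ : LocIntOn a₁) (ha₂ : LocIntOn a₂) (hy₀ : 0 ≤ y₀)
    (y₁ y₂ : ℝ → ℝ) (hy₁ : IsMaxSol a₁ y₀ y₁) (hy₂ : IsMaxSol a₂ y₀ y₂) :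
    ∃ h : ℝ → ℝ, LocIntOn h ∧
      (∀ t : ℝ, 0 ≤ t →
        |Real.sqrt (y₁ t) - Real.sqrt (y₂ t)| = ∫ s in (0:ℝ)..t, h s) ∧
      (∀ᵐ s ∂(MeasureTheory.volume : MeasureTheory.Measure ℝ), 0 ≤ s →
        h s ≤ |a₁ s - a₂ s|) := by
  set b₁ := (Ici (0:ℝ)).indicator a₁ with hb₁
  set b₂ := (Ici (0:ℝ)).indicator a₂ with hb₂
  have hl₁ : LocallyIntegrable b₁ volume := locInt_indicator ha₁
  have hl₂ : LocallyIntegrable b₂ volume := locInt_indicator ha₂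
  set c := Real.sqrt y₀
  have hc : 0 ≤ c := Real.sqrt_nonneg _
  have e₁ : ∀ t, 0 ≤ t → Real.sqrt (y₁ t) = skor b₁ c t := fun t ht => sqrt_maxSol ha₁ hy₀ hy₁ ht
  have e₂ : ∀ t, 0 ≤ t → Real.sqrt (y₂ t) = skor b₂ c t := fun t ht => sqrt_maxSol ha₂ hy₀ hy₂ ht
  set f : ℝ → ℝ := fun t => |skor b₁ c t - skor b₂ c t| with hf
  have hac : ∀ t, 0 ≤ t → AbsolutelyContinuousOnInterval f 0 t := by
    intro t ht
    refine ac_dom (C := 1) ht ((skor_ac hl₁ (c := c) le_rfl ht).fun_sub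
      (skor_ac hl₂ (c := c) le_rfl ht)) ?_
    intro u v _ _ _
    rw [one_mul]
    exact abs_abs_sub_abs_le_abs_sub _ _
  refine ⟨deriv f, ?_, ?_, ?_⟩
  · intro t ht
    exact (intervalIntegrable_iff_integrableOn_Icc_of_le ht).1 (hac t ht).intervalIntegrable_deriv
  · intro t ht
    rw [(hac t ht).integral_deriv_eq_sub, e₁ t ht, e₂ t ht]
    simp [hf, skor_zero hl₁ hc, skor_zero hl₂ hc]
  · have hD : LocallyIntegrable (fun x => |b₁ x - b₂ x|) volume := li_abs (hl₁.sub hl₂)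
    have hne : ∀ᵐ x : ℝ, x ≠ 0 := by simp [ae_iff, measure_singleton]
    filter_upwards [prim_ae hD, hne] with x hx hx0 hxn
    have hxpos : 0 < x := hxn.lt_of_ne' hx0
    have hb : |b₁ x - b₂ x| = |a₁ x - a₂ x| := by
      rw [hb₁, hb₂, indicator_of_mem (show x ∈ Ici (0:ℝ) from hxn),
        indicator_of_mem (show x ∈ Ici (0:ℝ) from hxn)]
    by_cases hdf : DifferentiableAt ℝ f x
    swap
    · rw [deriv_zero_of_not_differentiableAt hdf]; exact abs_nonneg _
    rw [← hb]
    have hmono : ∀ s t, 0 ≤ s → s ≤ t → f t ≤ f s +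
        (prim (fun x => |b₁ x - b₂ x|) t - prim (fun x => |b₁ x - b₂ x|) s) := by
      intro s t hs hst
      refine abs_le'.2 ⟨skor_contr hl₁ hl₂ hs hst, ?_⟩
      have := skor_contr hl₂ hl₁ (c := c) hs hst
      simp only [abs_sub_comm (b₂ _) (b₁ _), abs_sub_comm (skor b₂ c _) (skor b₁ c _)] at this
      rw [neg_sub]
      exact this
    have hd := hx.sub hdf.hasDerivAt
    have h0 : 0 ≤ |b₁ x - b₂ x| - deriv f x := by
      refine (hd.hasDerivWithinAt (s := Ici 0)).nonneg_of_monotoneOn ?_ ?_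
      · have h1 : AccPt x (𝓟 univ) := by
          rw [AccPt, principal_univ, inf_top_eq]; infer_instance
        rw [accPt_iff_nhds] at h1 ⊢
        intro U hU
        obtain ⟨y, hy, hyx⟩ := h1 (U ∩ Ici 0) (inter_mem hU (Ici_mem_nhds hxpos))
        exact ⟨y, hy.1, hyx⟩
      · intro s hs t _ hst
        have := hmono s t hs hst
        simp only [Pi.sub_apply]
        linarith
    linarith
end
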